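/- arXiv:1307.7322 — 6 statements merged into one kernel-verified Lean document; each statement's English description precedes it below -/
import Mathlib

section
/- Let (C,V) be an unweighted fallback election, let p ∈ C, and let k ≥ 0. If there exists a list S = (s_1,…,s_k) of fallback votes over C such that p is the unique fallback winner of the election (C, V ∪ S), then p is also the unique fallback winner of (C, V ∪ T), where T = (t_1,…,t_k) is the list of k fallback votes each of which approves exactly the set {p} (with p as its only ranked candidate). -/
namespace Voting

/-- A weighted voting profile: each entry is a ranking (a list of candidates,
most preferred first; for fallback votes this is the ranking of the approved
candidates) together with a nonnegative integer weight. -/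
abbrev Profile (C : Type*) := List (List C × ℕ)

variable {C : Type*} [DecidableEq C]

/-- Total weight of all votes. -/
def totalWeight (V : Profile C) : ℕ := (V.map Prod.snd).sum

/-- The (weighted) majority threshold `⌊W/2⌋ + 1`. -/
def maj (V : Profile C) : ℕ := totalWeight V / 2 + 1

/-- Level-`j` score of candidate `c`: the total weight of the votes ranking `c`
among their top `j` positions. -/
def levelScore (V : Profile C) (j : ℕ) (c : C) : ℕ :=
  (V.map (fun vw => if c ∈ vw.1.take j then vw.2 else 0)).sum

/-- Approval score of `c`: the total weight of the votes approving (i.e., ranking) `c`. -/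
def approvalScore (V : Profile C) (c : C) : ℕ :=
  (V.map (fun vw => if c ∈ vw.1 then vw.2 else 0)).sum

/-- Some candidate reaches the majority threshold at some level. -/
def someMaj (V : Profile C) : Prop := ∃ (j : ℕ) (d : C), maj V ≤ levelScore V j d

/-- The smallest level at which some candidate reaches the majority threshold
(the minimum Bucklin/fallback score). -/
noncomputable def majLevel (V : Profile C) : ℕ := sInf {j : ℕ | ∃ d : C, maj V ≤ levelScore V j d}

/-- `c` is a Bucklin winner of `V`: it reaches the majority threshold at the minimum
level `ℓ = majLevel V` and its level-`ℓ` score is maximum. -/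
def BucklinWinner (V : Profile C) (c : C) : Prop :=
  maj V ≤ levelScore V (majLevel V) c ∧
    ∀ d : C, levelScore V (majLevel V) d ≤ levelScore V (majLevel V) c

/-- `c` is the unique Bucklin winner of `V`. -/
def UniqueBucklinWinner (V : Profile C) (c : C) : Prop :=
  BucklinWinner V c ∧ ∀ d : C, BucklinWinner V d → d = c

/-- `c` is a fallback winner of `V`: if some candidate reaches a weighted majority at
some level, the fallback winners are the Bucklin winners; otherwise they are the
candidates with maximum approval score. -/
def FallbackWinner (V : Profile C) (c : C) : Prop :=
  (someMaj V ∧ BucklinWinner V c) ∨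
    (¬ someMaj V ∧ ∀ d : C, approvalScore V d ≤ approvalScore V c)

/-- `c` is the unique fallback winner of `V`. -/
def UniqueFallbackWinner (V : Profile C) (c : C) : Prop :=
  FallbackWinner V c ∧ ∀ d : C, FallbackWinner V d → d = c

/-- A Bucklin vote over `C`: a linear order (ranking) of all candidates. -/
structure BVote (C : Type*) where
  ranking : List C
  nodup : ranking.Nodup
  complete : ∀ c : C, c ∈ ranking

/-- A fallback vote over `C`: an approval set together with a linear ranking of it,
represented as the list of approved candidates in ranked order. -/
structure FBVote (C : Type*) where
  ranking : List C
  nodup : ranking.Nodup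

/-- Profile of a weighted Bucklin election. -/
def bprof (V : List (BVote C × ℕ)) : Profile C := V.map (fun x => (x.1.ranking, x.2))

/-- Profile of a weighted fallback election. -/
def fprof (V : List (FBVote C × ℕ)) : Profile C := V.map (fun x => (x.1.ranking, x.2))

/-- Profile of an unweighted Bucklin election (all weights 1). -/
def ubprof (V : List (BVote C)) : Profile C := V.map (fun x => (x.ranking, 1))

/-- Profile of an unweighted fallback election (all weights 1). -/
def ufprof (V : List (FBVote C)) : Profile C := V.map (fun x => (x.ranking, 1))

end Voting

open Voting

namespace Voting

theorem fb_transfer {C : Type*} [DecidableEq C] (A B : Profile C) (p : C)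
    (hm : maj B = maj A)
    (hp : ∀ j, levelScore A j p ≤ levelScore B j p)
    (hd : ∀ j d, d ≠ p → levelScore B j d ≤ levelScore A j d)
    (ap : approvalScore A p ≤ approvalScore B p)
    (ad : ∀ d, d ≠ p → approvalScore B d ≤ approvalScore A d)
    (h : UniqueFallbackWinner A p) : UniqueFallbackWinner B p := by
  have key : ∀ (_ : someMaj B),
      (∀ d, d ≠ p → levelScore B (majLevel B) d < maj B ∨
        levelScore B (majLevel B) d < levelScore B (majLevel B) p) →
      UniqueFallbackWinner B p := by
    intro hs hlt
    have hex : ∃ d, maj B ≤ levelScore B (majLevel B) d :=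
      Nat.sInf_mem (s := {j : ℕ | ∃ d : C, maj B ≤ levelScore B j d}) hs
    have hpm : maj B ≤ levelScore B (majLevel B) p := by
      obtain ⟨d, hd'⟩ := hex
      by_cases e : d = p
      · exact e ▸ hd'
      · have := hlt d e
        omega
    have hall : ∀ d, d ≠ p → levelScore B (majLevel B) d < levelScore B (majLevel B) p := by
      intro d e
      have := hlt d e
      omega
    refine ⟨Or.inl ⟨hs, hpm, fun d => ?_⟩, fun d hw => ?_⟩
    · by_cases e : d = p
      · rw [e]
      · exact (hall d e).le
    · by_contra e
      rcases hw with ⟨_, _, hw⟩ | ⟨hn, _⟩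
      · have h1 := hw p
        have h2 := hall d e
        omega
      · exact hn hs
  obtain ⟨hw, hu⟩ := h
  rcases hw with ⟨hs, h1, h2⟩ | ⟨hn, h2⟩
  · have hsB : maj B ≤ levelScore B (majLevel A) p := by
      have := hp (majLevel A)
      omega
    have hle : majLevel B ≤ majLevel A := Nat.sInf_le ⟨p, hsB⟩
    refine key ⟨_, _, hsB⟩ fun d e => ?_
    rcases hle.lt_or_eq with hlt | heq
    · left
      by_contra hc
      have h3 := hd (majLevel B) d e
      exact Nat.notMem_of_lt_sInf hlt ⟨d, by omega⟩
    · right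
      rw [heq]
      by_contra hc
      have h3 := hd (majLevel A) d e
      have h4 := hp (majLevel A)
      exact e (hu d (Or.inl ⟨hs, by omega, fun x => (h2 x).trans (by omega)⟩))
  · have hno : ∀ j d, levelScore A j d < maj A := by
      intro j d
      by_contra hc
      exact hn ⟨j, d, by omega⟩
    by_cases hs : someMaj B
    · refine key hs fun d e => Or.inl ?_
      have h3 := hd (majLevel B) d e
      have h4 := hno (majLevel B) d
      omega
    · have hall : ∀ d, d ≠ p → approvalScore B d < approvalScore B p := by
        intro d e
        by_contra hc
        have h3 := ad d e
        exact e (hu d (Or.inr ⟨hn, fun x => (h2 x).trans (by omega)⟩))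
      refine ⟨Or.inr ⟨hs, fun d => ?_⟩, fun d hw => ?_⟩
      · by_cases e : d = p
        · rw [e]
        · exact (hall d e).le
      · by_contra e
        rcases hw with ⟨hs', _⟩ | ⟨_, hw⟩
        · exact hs hs'
        · have h1 := hw p
          have h2 := hall d e
          omega

theorem ite_sum_le {α : Type*} (S : List α) (P : α → Prop) [DecidablePred P] :
    (S.map (fun x => if P x then 1 else 0)).sum ≤ S.length := by
  induction S with
  | nil => simp
  | cons a S ih =>
    simp only [List.map_cons, List.sum_cons, List.length_cons]
    split_ifs <;> omega

end Voting

/-- If some list `S` of `k` fallback votes makes `p` the unique fallback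
winner of `(C, V ∪ S)`, then so does the list `T` of `k` votes each approving exactly `{p}`. -/
theorem stmt_0 {C : Type*} [Fintype C] [DecidableEq C]
    (V : List (FBVote C)) (p : C) (k : ℕ)
    (S : List (FBVote C)) (hlen : S.length = k)
    (hwin : UniqueFallbackWinner (ufprof (V ++ S)) p) :
    UniqueFallbackWinner
      (ufprof (V ++ List.replicate k (⟨[p], List.nodup_singleton p⟩ : FBVote C))) p := by
  subst hlen
  refine fb_transfer _ _ p ?_ ?_ ?_ ?_ ?_ hwin
  · simp [maj, totalWeight, ufprof, Function.comp_def]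
  · intro j
    rcases j with _ | j
    · simp [levelScore]
    · have := ite_sum_le S (fun x => p ∈ x.ranking.take (j+1))
      simpa [levelScore, ufprof, Function.comp_def] using this
  · intro j d e
    rcases j with _ | j
    · simp [levelScore]
    · simp [levelScore, ufprof, Function.comp_def, e]
  · have := ite_sum_le S (fun x => p ∈ x.ranking)
    simpa [approvalScore, ufprof, Function.comp_def] using this
  · intro d e
    simp [approvalScore, ufprof, Function.comp_def, e]
end

section
/- Let (C,V) be a weighted fallback election in which vote v_i has nonnegative integer weight w_i, let p ∈ C, and let nonnegative integer weights w'_1,…,w'_k be given for k manipulators. If there exists a list S = (s_1,…,s_k) of fallback votes over C, where s_j has weight w'_j, such that p is the unique fallback winner of (C, V ∪ S), then p is also the unique fallback winner of (C, V ∪ T), where T consists of k votes of weights w'_1,…,w'_k each approving exactly the set {p}. -/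
open Voting

theorem unique_of_compare {C : Type*} [DecidableEq C] (A B : Profile C) (p : C)
    (hm : maj B = maj A)
    (hz : ∀ c, levelScore B 0 c = 0)
    (hd : ∀ j d, d ≠ p → levelScore B j d ≤ levelScore A j d)
    (hp : ∀ j, 1 ≤ j → levelScore A j p ≤ levelScore B j p)
    (had : ∀ d, d ≠ p → approvalScore B d ≤ approvalScore A d)
    (hap : approvalScore A p ≤ approvalScore B p)
    (hz' : ∀ c, levelScore A 0 c = 0)
    (hwin : UniqueFallbackWinner A p) : UniqueFallbackWinner B p := by
  have hpos : 1 ≤ maj A := by unfold maj; omega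
  obtain ⟨hw, hu⟩ := hwin
  by_cases hB : someMaj B
  · have hne : {j : ℕ | ∃ d : C, maj B ≤ levelScore B j d}.Nonempty := hB
    obtain ⟨d₀, hd₀⟩ : ∃ d : C, maj B ≤ levelScore B (majLevel B) d := Nat.sInf_mem hne
    have key : maj B ≤ levelScore B (majLevel B) p ∧
        ∀ d, d ≠ p → levelScore B (majLevel B) d < levelScore B (majLevel B) p := by
      have hj1 : 1 ≤ majLevel B := by
        by_contra hcon
        have h0 : majLevel B = 0 := by omega
        rw [h0, hz] at hd₀
        omega
      by_cases hex : ∃ d, d ≠ p ∧ maj B ≤ levelScore B (majLevel B) d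
      · obtain ⟨d, hdp, hdm⟩ := hex
        have hAd : maj A ≤ levelScore A (majLevel B) d := by
          have := hd (majLevel B) d hdp
          omega
        have hA : someMaj A := ⟨_, d, hAd⟩
        have hle : majLevel A ≤ majLevel B := Nat.sInf_le ⟨d, hAd⟩
        have hbw : BucklinWinner A p := by
          rcases hw with h | h
          · exact h.2
          · exact absurd hA h.1
        have hA1 : 1 ≤ majLevel A := by
          by_contra hcon
          have h0 : majLevel A = 0 := by omega
          have := hbw.1
          rw [h0, hz'] at this
          omega
        have hge : majLevel B ≤ majLevel A := by
          refine Nat.sInf_le ⟨p, ?_⟩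
          have := hp _ hA1
          have := hbw.1
          omega
        have heq : majLevel B = majLevel A := le_antisymm hge hle
        rw [heq]
        have h1 := hp _ hA1
        have h2 := hbw.1
        refine ⟨by omega, fun e he => ?_⟩
        have h3 := hd (majLevel A) e he
        have h4 := hbw.2 e
        by_contra hcon
        have h5 : levelScore A (majLevel A) e = levelScore A (majLevel A) p := by omega
        refine he (hu e (Or.inl ⟨hA, ?_, ?_⟩))
        · rw [h5]; exact h2
        · rw [h5]; exact hbw.2
      · push Not at hex
        have : d₀ = p := by
          by_contra hcon
          have := hex d₀ hcon
          omega
        subst this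
        exact ⟨hd₀, fun d h => lt_of_lt_of_le (hex d h) hd₀⟩
    refine ⟨Or.inl ⟨hB, key.1, fun d => ?_⟩, fun d hdw => ?_⟩
    · by_cases h : d = p
      · rw [h]
      · exact (key.2 d h).le
    · by_contra h
      rcases hdw with h' | h'
      · have := h'.2.2 p
        have := key.2 d h
        omega
      · exact h'.1 hB
  · have hA : ¬ someMaj A := by
      intro hA
      have hbw : BucklinWinner A p := by
        rcases hw with h | h
        · exact h.2
        · exact absurd hA h.1
      have hA1 : 1 ≤ majLevel A := by
        by_contra hcon
        have h0 : majLevel A = 0 := by omega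
        have := hbw.1
        rw [h0, hz'] at this
        omega
      refine hB ⟨majLevel A, p, ?_⟩
      have := hp _ hA1
      have := hbw.1
      omega
    have hmax : ∀ d, approvalScore A d ≤ approvalScore A p := by
      rcases hw with h | h
      · exact absurd h.1 hA
      · exact h.2
    have key : ∀ d, d ≠ p → approvalScore B d < approvalScore B p := by
      intro d h
      have h1 := hmax d
      have h2 := had d h
      by_contra hcon
      have h5 : approvalScore A d = approvalScore A p := by omega
      refine h (hu d (Or.inr ⟨hA, ?_⟩))
      rw [h5]; exact hmax
    refine ⟨Or.inr ⟨hB, fun d => ?_⟩, fun d hdw => ?_⟩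
    · by_cases h : d = p
      · rw [h]
      · exact (key d h).le
    · by_contra h
      rcases hdw with h' | h'
      · exact hB h'.1
      · have := h'.2 p
        have := key d h
        omega

/-- weighted variant of Statement 0: if some list `S` of `k` fallback votes
of weights `w 0, …, w (k-1)` makes `p` the unique fallback winner of `(C, V ∪ S)`,
then so does the list `T` of `k` votes of the same weights each approving exactly `{p}`. -/
theorem stmt_1 {C : Type*} [Fintype C] [DecidableEq C]
    (V : List (FBVote C × ℕ)) (p : C) (k : ℕ) (w : Fin k → ℕ)
    (S : Fin k → FBVote C)
    (hwin : UniqueFallbackWinner (fprof (V ++ List.ofFn (fun i => (S i, w i)))) p) :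
    UniqueFallbackWinner
      (fprof (V ++ List.ofFn (fun i =>
        ((⟨[p], List.nodup_singleton p⟩ : FBVote C), w i)))) p := by
  apply unique_of_compare _ _ p _ _ _ _ _ _ _ hwin
  · simp [maj, totalWeight, fprof, List.map_ofFn, List.sum_ofFn]
  · intro c
    simp [levelScore]
  · intro j d hd
    simp only [levelScore, fprof, List.map_append, List.map_ofFn, List.sum_append, List.sum_ofFn]
    refine Nat.add_le_add_left (Finset.sum_le_sum fun i _ => ?_) _
    have : d ∉ [p].take j := fun h => hd (by simpa using List.mem_of_mem_take h)
    simp [this]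
  · intro j hj
    simp only [levelScore, fprof, List.map_append, List.map_ofFn, List.sum_append, List.sum_ofFn]
    refine Nat.add_le_add_left (Finset.sum_le_sum fun i _ => ?_) _
    have : p ∈ [p].take j := by
      obtain ⟨m, rfl⟩ := Nat.exists_eq_add_of_le' hj
      simp
    simp only [Function.comp, this, if_true]
    split_ifs <;> simp
  · intro d hd
    simp only [approvalScore, fprof, List.map_append, List.map_ofFn, List.sum_append, List.sum_ofFn]
    refine Nat.add_le_add_left (Finset.sum_le_sum fun i _ => ?_) _
    simp [hd]
  · simp only [approvalScore, fprof, List.map_append, List.map_ofFn, List.sum_append, List.sum_ofFn]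
    refine Nat.add_le_add_left (Finset.sum_le_sum fun i _ => ?_) _
    simp only [Function.comp, List.mem_singleton, if_true]
    split_ifs <;> simp
  · intro c
    simp [levelScore]
end

section
/- Let (C,V) be an unweighted Bucklin election with m = |C| candidates, let p ∈ C, let k ≥ 0, set maj = ⌊(|V|+k)/2⌋ + 1, and let r_min = min{ i : score^i_{(C,V)}(p) + k ≥ maj }. Suppose there exists a candidate c ∈ C − {p} such that either (a) min{ i : score^i_{(C,V)}(c) ≥ maj } < r_min, or (b) score^{r_min}_{(C,V)}(c) ≥ score^{r_min}_{(C,V)}(p) + k. Then for every list S of k votes (linear orders on C), p is not the unique Bucklin winner of (C, V ∪ S). -/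
open Voting

/-- with `maj = ⌊(|V|+k)/2⌋+1` and
`r_min = min { i | score^i_{(C,V)}(p) + k ≥ maj }`, if some candidate `c ≠ p` either
reaches `maj` (from `V` alone) at a level `< r_min`, or satisfies
`score^{r_min}(c) ≥ score^{r_min}(p) + k`, then no list `S` of `k` votes makes `p`
the unique Bucklin winner of `(C, V ∪ S)`. -/
theorem stmt_3 {C : Type*} [Fintype C] [DecidableEq C]
    (V : List (BVote C)) (p : C) (k : ℕ)
    (mj rmin : ℕ)
    (hmj : mj = (V.length + k) / 2 + 1)
    (hrmin : rmin = sInf {i : ℕ | mj ≤ levelScore (ubprof V) i p + k})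
    (c : C) (hcp : c ≠ p)
    (hcond : (∃ i < rmin, mj ≤ levelScore (ubprof V) i c) ∨
      levelScore (ubprof V) rmin p + k ≤ levelScore (ubprof V) rmin c) :
    ∀ S : List (BVote C), S.length = k → ¬ UniqueBucklinWinner (ubprof (V ++ S)) p := by
  intro S hS hU
  obtain ⟨⟨h1, h2⟩, h3⟩ := hU
  have hmaj : maj (ubprof (V ++ S)) = mj := by
    simp [maj, totalWeight, ubprof, Function.comp_def, hmj, hS]
  have hadd : ∀ j d, levelScore (ubprof (V ++ S)) j d
      = levelScore (ubprof V) j d + levelScore (ubprof S) j d := by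
    intro j d
    simp [levelScore, ubprof]
  have hle : ∀ (T : List (BVote C)) j d, levelScore (ubprof T) j d ≤ T.length := by
    intro T j d
    induction T with
    | nil => simp [levelScore, ubprof]
    | cons t T ih =>
      simp only [levelScore, ubprof, List.map_cons, List.sum_cons, List.length_cons] at ih ⊢
      split_ifs <;> omega
  have hmin : ∀ j d, mj ≤ levelScore (ubprof (V ++ S)) j d → majLevel (ubprof (V ++ S)) ≤ j := by
    intro j d h
    exact Nat.sInf_le ⟨d, hmaj ▸ h⟩
  rw [hmaj] at h1
  have hSk := hle S (majLevel (ubprof (V ++ S))) p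
  have h1' := h1
  rw [hadd] at h1'
  have hmem : majLevel (ubprof (V ++ S)) ∈ {i : ℕ | mj ≤ levelScore (ubprof V) i p + k} := by
    simp only [Set.mem_setOf_eq]
    omega
  have hr : rmin ≤ majLevel (ubprof (V ++ S)) := hrmin ▸ Nat.sInf_le hmem
  have hrm : mj ≤ levelScore (ubprof V) rmin p + k := by
    have h := Nat.sInf_mem ⟨_, hmem⟩
    rw [← hrmin] at h
    exact h
  rcases hcond with ⟨i, hi, hc⟩ | hc
  · have := hmin i c (by rw [hadd]; omega)
    omega
  · have hl := hmin rmin c (by rw [hadd]; omega)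
    have he : majLevel (ubprof (V ++ S)) = rmin := le_antisymm hl hr
    have hpc : levelScore (ubprof (V ++ S)) (majLevel (ubprof (V ++ S))) p
        ≤ levelScore (ubprof (V ++ S)) (majLevel (ubprof (V ++ S))) c := by
      rw [he] at hSk ⊢
      rw [hadd, hadd]
      omega
    exact hcp (h3 c ⟨by rw [hmaj]; exact h1.trans hpc, fun d => (h2 d).trans hpc⟩)
end

section
/- Let C be a finite candidate set, v a linear order on C, π : C × C → ℕ a swap-bribery price function, p ∈ C, and ℓ, k nonnegative integers. Let C' be a set of |C| − 1 new candidates disjoint from C ∪ {d} (d a further new candidate), partitioned into C'_1 with |C'_1| = ℓ and C'_2 = C' − C'_1. Let A = C ∪ C' ∪ {d} and consider the two-voter unweighted Bucklin election (A, {v_1, v_2}) where v_1 ranks d first, then the candidates of C in the order given by v, then the candidates of C' in some fixed order, with price function π_1(x,y) = π(x,y) if x,y ∈ C and π_1(x,y) = k+1 otherwise; and v_2 ranks p first, then the candidates of C'_1, then d, then the candidates of C'_2, then the candidates of C − {p}, with price function π_2 ≡ k+1. Then there is a sequence of swaps of adjacent candidates in v_1 and v_2, of total cost at most k (each swap of adjacent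 candidates x immediately above y in the current ranking of voter i costing π_i(x,y)), after which p is the unique Bucklin winner of the resulting election, if and only if there is a sequence of swaps of adjacent candidates in v, of total cost at most k with respect to π, after which p is ranked among the top ℓ positions of v. -/
open Voting

/-- `SwapSeq π l l' cost`: there is a sequence of swaps of adjacent candidates
transforming the ranking `l` into the ranking `l'`, where a swap of `x` immediately
above `y` costs `π x y`, and whose total cost is `cost`. -/
inductive SwapSeq {A : Type*} (π : A → A → ℕ) : List A → List A → ℕ → Prop
  | refl (l : List A) : SwapSeq π l l 0
  | step {l : List A} {cost : ℕ} (pre suf : List A) (x y : A) :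
      SwapSeq π l (pre ++ x :: y :: suf) cost →
      SwapSeq π l (pre ++ y :: x :: suf) (cost + π x y)

/-- The candidate set `A = C ∪ C' ∪ {d}` of the swap-bribery reduction, where
`C'` is a set of `|C| − 1` new candidates and `d` one further new candidate. -/
abbrev Cand14 (C : Type*) [Fintype C] : Type _ :=
  C ⊕ (Fin (Fintype.card C - 1) ⊕ Unit)

/-- The new candidate `d`. -/
def d14 (C : Type*) [Fintype C] : Cand14 C := Sum.inr (Sum.inr ())

/-- The new candidates of `C'`. -/
def pad14 (C : Type*) [Fintype C] (i : Fin (Fintype.card C - 1)) : Cand14 C :=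
  Sum.inr (Sum.inl i)

/-- The vote `v₁`: `d` first, then the candidates of `C` in the order of `v`, then the
candidates of `C'` in a fixed order. -/
def v1_14 (C : Type*) [Fintype C] (v : List C) : List (Cand14 C) :=
  d14 C :: (v.map Sum.inl ++ (List.finRange (Fintype.card C - 1)).map (pad14 C))

/-- The vote `v₂`: `p` first, then the `ℓ` candidates of `C'₁`, then `d`, then the
remaining candidates of `C'`, then the candidates of `C − {p}` in the order of `v`. -/
def v2_14 (C : Type*) [DecidableEq C] [Fintype C] (v : List C) (p : C) (ℓ : ℕ) :
    List (Cand14 C) :=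
  Sum.inl p ::
    (((List.finRange (Fintype.card C - 1)).take ℓ).map (pad14 C) ++
      d14 C :: (((List.finRange (Fintype.card C - 1)).drop ℓ).map (pad14 C) ++
        (v.erase p).map Sum.inl))

/-- The swap-bribery price function of `v₁`: `π` on pairs from `C`, `k+1` otherwise. -/
def π1_14 (C : Type*) [Fintype C] (π : C → C → ℕ) (k : ℕ) :
    Cand14 C → Cand14 C → ℕ :=
  fun x y =>
    match x, y with
    | Sum.inl a, Sum.inl b => π a b
    | _, _ => k + 1

/-- The swap-bribery price function of `v₂`: constantly `k+1`. -/
def π2_14 (C : Type*) [Fintype C] (k : ℕ) : Cand14 C → Cand14 C → ℕ := fun _ _ => k + 1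

theorem swap_length14 {A : Type*} {π : A → A → ℕ} {l l' : List A} {c : ℕ}
    (h : SwapSeq π l l' c) : l'.length = l.length := by
  induction h with
  | refl => rfl
  | step pre suf x y _ ih => simpa using ih

theorem swap_v1_14 {C : Type*} [Fintype C] (v : List C) (π : C → C → ℕ) (k : ℕ)
    {l1 : List (Cand14 C)} {c : ℕ} (h : SwapSeq (π1_14 C π k) (v1_14 C v) l1 c) (hc : c ≤ k) :
    ∃ v', l1 = v1_14 C v' ∧ SwapSeq π v v' c := by
  generalize hm : v1_14 C v = m at h
  induction h with
  | refl => exact ⟨v, hm.symm, SwapSeq.refl v⟩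
  | step pre suf x y _ ih =>
    obtain ⟨v', h1, h2⟩ := ih (by omega)
    rcases x with a | x
    swap
    · have : π1_14 C π k (Sum.inr x) y = k + 1 := by cases y <;> rfl
      omega
    rcases y with b | y
    swap
    · have : π1_14 C π k (Sum.inl a) (Sum.inr y) = k + 1 := rfl
      omega
    unfold v1_14 at h1
    rcases pre with _ | ⟨z, pre⟩
    · simp [d14] at h1
    simp only [List.cons_append, List.cons.injEq] at h1
    obtain ⟨rfl, h1⟩ := h1
    rcases List.append_eq_append_iff.1 h1 with ⟨as, h3, h4⟩ | ⟨bs, h3, h4⟩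
    · rcases as with _ | ⟨z1, _ | ⟨z2, as⟩⟩
      · exfalso
        have : (Sum.inl a : Cand14 C) ∈
            (List.finRange (Fintype.card C - 1)).map (pad14 C) := by
          rw [List.nil_append] at h4
          rw [← h4]; simp
        simp [pad14] at this
      · exfalso
        have : (Sum.inl b : Cand14 C) ∈
            (List.finRange (Fintype.card C - 1)).map (pad14 C) := by
          simp only [List.cons_append, List.nil_append, List.cons.injEq] at h4
          rw [← h4.2]; simp
        simp [pad14] at this
      · simp only [List.cons_append, List.cons.injEq] at h4
        obtain ⟨rfl, rfl, rfl⟩ := h4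
        obtain ⟨q1, q2, rfl, rfl, h5⟩ := List.map_eq_append_iff.1 h3
        obtain ⟨a', q3, rfl, h6, h7⟩ := List.map_eq_cons_iff.1 h5
        obtain ⟨b', q4, rfl, h8, rfl⟩ := List.map_eq_cons_iff.1 h7
        obtain rfl := Sum.inl.inj h6
        obtain rfl := Sum.inl.inj h8
        exact ⟨q1 ++ b' :: a' :: q4, by simp [v1_14], SwapSeq.step q1 q4 a' b' h2⟩
    · exfalso
      have : (Sum.inl a : Cand14 C) ∈
            (List.finRange (Fintype.card C - 1)).map (pad14 C) := by
        rw [h4]; simp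
      simp [pad14] at this

theorem swap_v1_14' {C : Type*} [Fintype C] (v : List C) (π : C → C → ℕ) (k : ℕ)
    {v' : List C} {c : ℕ} (h : SwapSeq π v v' c) :
    SwapSeq (π1_14 C π k) (v1_14 C v) (v1_14 C v') c := by
  induction h with
  | refl => exact SwapSeq.refl _
  | step pre suf x y _ ih =>
    have := SwapSeq.step (π := π1_14 C π k) (l := v1_14 C v) (d14 C :: pre.map Sum.inl)
      (suf.map Sum.inl ++ (List.finRange (Fintype.card C - 1)).map (pad14 C))
      (Sum.inl x) (Sum.inl y) (by simpa [v1_14] using ih)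
    simpa [v1_14, π1_14] using this

theorem swap_v2_14 {C : Type*} [Fintype C] (k : ℕ)
    {l l2 : List (Cand14 C)} {c : ℕ} (h : SwapSeq (π2_14 C k) l l2 c) (hc : c ≤ k) :
    l2 = l ∧ c = 0 := by
  cases h with
  | refl => exact ⟨rfl, rfl⟩
  | step pre suf x y _ =>
    simp only [π2_14] at hc
    omega

theorem score14 {A : Type*} [DecidableEq A] (l1 l2 : List A) (j : ℕ) (c : A) :
    maj ([(l1, 1), (l2, 1)] : Profile A) ≤ levelScore [(l1, 1), (l2, 1)] j c ↔
      c ∈ l1.take j ∧ c ∈ l2.take j := by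
  simp only [maj, totalWeight, levelScore, List.map_cons, List.map_nil, List.sum_cons,
    List.sum_nil]
  split_ifs <;> simp_all

theorem score14_le {A : Type*} [DecidableEq A] (l1 l2 : List A) (j : ℕ) (c : A) :
    levelScore [(l1, 1), (l2, 1)] j c ≤ maj ([(l1, 1), (l2, 1)] : Profile A) := by
  simp only [maj, totalWeight, levelScore, List.map_cons, List.map_nil, List.sum_cons,
    List.sum_nil]
  split_ifs <;> simp

theorem winner14 {A : Type*} [DecidableEq A] (l1 l2 : List A) (c : A) :
    BucklinWinner ([(l1, 1), (l2, 1)] : Profile A) c ↔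
      c ∈ l1.take (majLevel [(l1, 1), (l2, 1)]) ∧ c ∈ l2.take (majLevel [(l1, 1), (l2, 1)]) := by
  rw [← score14]
  exact ⟨fun h => h.1, fun h => ⟨h, fun d => (score14_le _ _ _ _).trans h⟩⟩

theorem take_mono14 {A : Type*} {l : List A} {i j : ℕ} (h : i ≤ j) {c : A}
    (hc : c ∈ l.take i) : c ∈ l.take j :=
  (List.take_subset_take_left l h) hc

/-- correctness of the reduction from Single-Vote Swap Bribery to
Bucklin-CUSB with two voters. -/
theorem stmt_14 {C : Type*} [DecidableEq C] [Fintype C]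
    (v : List C) (hvnd : v.Nodup) (hvc : ∀ x : C, x ∈ v)
    (π : C → C → ℕ) (p : C) (ℓ k : ℕ) (hℓ : ℓ ≤ Fintype.card C - 1) :
    (∃ (l1 l2 : List (Cand14 C)) (c1 c2 : ℕ),
      SwapSeq (π1_14 C π k) (v1_14 C v) l1 c1 ∧
      SwapSeq (π2_14 C k) (v2_14 C v p ℓ) l2 c2 ∧
      c1 + c2 ≤ k ∧
      UniqueBucklinWinner ([(l1, 1), (l2, 1)] : Profile (Cand14 C)) (Sum.inl p)) ↔
    (∃ (v' : List C) (cost : ℕ),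
      SwapSeq π v v' cost ∧ cost ≤ k ∧ p ∈ v'.take ℓ) := by
  have hlen : v.length = Fintype.card C := by
    rw [← List.toFinset_card_of_nodup hvnd, ← Finset.card_univ]
    congr 1
    ext x
    simp [hvc]
  have hlt : ((List.finRange (Fintype.card C - 1)).take ℓ).length = ℓ := by
    simp [hℓ]
  have hpre : ∀ w : List C, w.length = v.length →
      (v1_14 C w).take (ℓ + 1) = d14 C :: (w.take ℓ).map Sum.inl := by
    intro w hw
    rw [v1_14, List.take_succ_cons, List.take_append_of_le_length, List.map_take]
    simp only [List.length_map]
    omega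
  constructor
  · rintro ⟨l1, l2, c1, c2, h1, h2, hc, hw, hu⟩
    obtain ⟨v', rfl, hv'⟩ := swap_v1_14 v π k h1 (by omega)
    obtain ⟨rfl, rfl⟩ := swap_v2_14 k h2 (by omega)
    refine ⟨v', c1, hv', by omega, ?_⟩
    rw [winner14] at hw
    have hL : majLevel [(v1_14 C v', 1), (v2_14 C v p ℓ, 1)] ≤ ℓ + 1 := by
      by_contra hcon
      have hd : d14 C = Sum.inl p := by
        apply hu
        rw [winner14]
        refine ⟨take_mono14 (i := 1) (by omega) (by simp [v1_14]),
          take_mono14 (i := ℓ + 2) (by omega) ?_⟩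
        rw [v2_14, List.take_succ_cons, List.take_append, List.length_map, hlt]
        simp
      simp [d14] at hd
    have := take_mono14 hL hw.1
    rw [hpre v' (swap_length14 hv')] at this
    simpa [d14, -List.map_take] using this
  · rintro ⟨v', cost, h, hc, hp⟩
    refine ⟨v1_14 C v', v2_14 C v p ℓ, cost, 0, swap_v1_14' v π k h, SwapSeq.refl _, by omega, ?_⟩
    have hpre' := hpre v' (swap_length14 h)
    have hpre2 : (v2_14 C v p ℓ).take (ℓ + 1) =
        Sum.inl p :: ((List.finRange (Fintype.card C - 1)).take ℓ).map (pad14 C) := by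
      rw [v2_14, List.take_succ_cons, List.take_append, List.length_map, hlt]
      simp
    have huniq : ∀ j ≤ ℓ + 1, ∀ e : Cand14 C, e ∈ (v1_14 C v').take j →
        e ∈ (v2_14 C v p ℓ).take j → e = Sum.inl p := by
      intro j hj e he1 he2
      have he1 := take_mono14 hj he1
      have he2 := take_mono14 hj he2
      rw [hpre'] at he1
      rw [hpre2] at he2
      rcases List.mem_cons.1 he2 with he2 | he2
      · exact he2
      exfalso
      obtain ⟨i, _, rfl⟩ := List.mem_map.1 he2
      simp [d14, pad14, -List.map_take] at he1
    have hmem : ℓ + 1 ∈ {j : ℕ | ∃ e : Cand14 C,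
        maj ([(v1_14 C v', 1), (v2_14 C v p ℓ, 1)] : Profile (Cand14 C)) ≤
          levelScore [(v1_14 C v', 1), (v2_14 C v p ℓ, 1)] j e} := by
      refine ⟨Sum.inl p, ?_⟩
      rw [score14, hpre', hpre2]
      refine ⟨?_, by simp⟩
      exact List.mem_cons_of_mem _ (List.mem_map_of_mem hp)
    have hle : majLevel [(v1_14 C v', 1), (v2_14 C v p ℓ, 1)] ≤ ℓ + 1 := Nat.sInf_le hmem
    obtain ⟨e, he⟩ := Nat.sInf_mem ⟨_, hmem⟩
    change maj _ ≤ levelScore _ (majLevel _) _ at he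
    rw [score14] at he
    obtain rfl := huniq _ hle e he.1 he.2
    refine ⟨(winner14 _ _ _).2 he, fun f hf => ?_⟩
    rw [winner14] at hf
    exact huniq _ hle f hf.1 hf.2
end

section
/- Let (C,V) be an unweighted fallback election with extension bribery price functions δ_1,…,δ_n, each δ_i : ℕ → ℕ nondecreasing with δ_i(0) = 0, let p ∈ C, and let k ≥ 0. Suppose the votes are extended as follows: each voter i adds some set A_i of previously disapproved candidates to the bottom of its ranking of approved candidates (in some order), with total cost Σ_{i=1}^{n} δ_i(|A_i|) ≤ k, and p is the unique fallback winner of the resulting election. Then the alternative extension in which each voter i with p ∈ A_i adds exactly the single candidate p at the last position of its ranking of approved candidates, and every other voter's vote is left unchanged, also makes p the unique fallback winner, and its total cost is at most k. -/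
open Voting

theorem aux_main {C : Type*} [DecidableEq C] (V V' : Profile C) (p : C)
    (hm : maj V' = maj V)
    (h1 : ∀ j d, d ≠ p → levelScore V' j d ≤ levelScore V j d)
    (h2 : ∀ j, levelScore V j p ≤ levelScore V' j p)
    (a1 : ∀ d, d ≠ p → approvalScore V' d ≤ approvalScore V d)
    (a2 : approvalScore V' p = approvalScore V p)
    (b1 : ∀ j, levelScore V' j p ≤ approvalScore V' p)
    (b2 : ∃ j, approvalScore V p ≤ levelScore V j p)
    (hwin : UniqueFallbackWinner V p) : UniqueFallbackWinner V' p := by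
  obtain ⟨hp, hu⟩ := hwin
  rcases hp with ⟨hs, hB, hmax⟩ | ⟨hs, hmax⟩
  · have hstrict : ∀ d, d ≠ p →
        levelScore V (majLevel V) d < levelScore V (majLevel V) p := by
      intro d hd
      refine lt_of_le_of_ne (hmax d) fun he => hd (hu d (Or.inl ⟨hs, ?_, ?_⟩))
      · rw [he]; exact hB
      · rw [he]; exact hmax
    have hmem : maj V' ≤ levelScore V' (majLevel V) p := by
      rw [hm]; exact hB.trans (h2 _)
    have hs' : someMaj V' := ⟨_, p, hmem⟩
    have hle : majLevel V' ≤ majLevel V := Nat.sInf_le ⟨p, hmem⟩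
    have hatt : ∃ d : C, maj V' ≤ levelScore V' (majLevel V') d :=
      Nat.sInf_mem (s := {j : ℕ | ∃ d : C, maj V' ≤ levelScore V' j d}) ⟨_, p, hmem⟩
    have key : maj V' ≤ levelScore V' (majLevel V') p ∧
        ∀ d, d ≠ p → levelScore V' (majLevel V') d < levelScore V' (majLevel V') p := by
      rcases hle.eq_or_lt with he | hlt
      · rw [he]
        exact ⟨hmem, fun d hd => (h1 _ d hd).trans_lt ((hstrict d hd).trans_le (h2 _))⟩
      · have hno : ∀ d, d ≠ p → levelScore V' (majLevel V') d < maj V' := by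
          intro d hd
          by_contra hc
          have h3 : majLevel V ≤ majLevel V' :=
            Nat.sInf_le ⟨d, by rw [← hm]; exact (not_lt.mp hc).trans (h1 _ d hd)⟩
          omega
        obtain ⟨d, hd⟩ := hatt
        have hdp : d = p := by
          by_contra hc
          exact absurd hd (not_le.mpr (hno d hc))
        subst hdp
        exact ⟨hd, fun e he => (hno e he).trans_le hd⟩
    refine ⟨Or.inl ⟨hs', key.1, fun d => ?_⟩, fun d hd => ?_⟩
    · by_cases hd : d = p
      · rw [hd]
      · exact (key.2 d hd).le
    · by_contra hc
      rcases hd with ⟨_, _, h4⟩ | ⟨h4, _⟩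
      · exact absurd (h4 p) (not_le.mpr (key.2 d hc))
      · exact h4 hs'
  · have hstrict : ∀ d, d ≠ p → approvalScore V d < approvalScore V p := by
      intro d hd
      refine lt_of_le_of_ne (hmax d) fun he => hd (hu d (Or.inr ⟨hs, ?_⟩))
      rw [he]; exact hmax
    have hs' : ¬ someMaj V' := by
      rintro ⟨j, d, hjd⟩
      by_cases hd : d = p
      · subst hd
        obtain ⟨j', hj'⟩ := b2
        have := b1 j
        exact hs ⟨j', d, by omega⟩
      · exact hs ⟨j, d, by rw [← hm]; exact hjd.trans (h1 j d hd)⟩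
    have key : ∀ d, d ≠ p → approvalScore V' d < approvalScore V' p := fun d hd => by
      have := a1 d hd
      have := hstrict d hd
      omega
    refine ⟨Or.inr ⟨hs', fun d => ?_⟩, fun d hd => ?_⟩
    · by_cases hd : d = p
      · rw [hd]
      · exact (key d hd).le
    · by_contra hc
      rcases hd with ⟨h4, _⟩ | ⟨_, h4⟩
      · exact hs' h4
      · exact absurd (h4 p) (not_le.mpr (key d hc))

theorem aux_level {C : Type*} [DecidableEq C] {n : ℕ} (W : Fin n → FBVote C) (j : ℕ) (c : C) :
    levelScore (ufprof (List.ofFn W)) j c =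
      ∑ i, if c ∈ (W i).ranking.take j then 1 else 0 := by
  simp [levelScore, ufprof, List.map_ofFn, List.sum_ofFn, Function.comp_def,
    -Finset.sum_boole]

theorem aux_appr {C : Type*} [DecidableEq C] {n : ℕ} (W : Fin n → FBVote C) (c : C) :
    approvalScore (ufprof (List.ofFn W)) c =
      ∑ i, if c ∈ (W i).ranking then 1 else 0 := by
  simp [approvalScore, ufprof, List.map_ofFn, List.sum_ofFn, Function.comp_def,
    -Finset.sum_boole]

theorem aux_maj {C : Type*} {n : ℕ} (W : Fin n → FBVote C) :
    maj (ufprof (List.ofFn W)) = n / 2 + 1 := by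
  simp [maj, totalWeight, ufprof, List.map_ofFn, List.sum_ofFn, Function.comp_def]

theorem aux_ite {P Q : Prop} [Decidable P] [Decidable Q] (h : P → Q) :
    (if P then 1 else 0 : ℕ) ≤ if Q then 1 else 0 := by
  split_ifs <;> simp_all

/-- if extending each vote `i` by a set `A i` of previously disapproved
candidates (appended below the approved candidates) has total cost at most `k` and makes
`p` the unique fallback winner, then the extension that only appends `p` (to exactly the
votes whose extension contained `p`) also makes `p` the unique fallback winner, at total
cost at most `k`. -/
theorem stmt_15 {C : Type*} [Fintype C] [DecidableEq C] (n : ℕ)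
    (vts : Fin n → FBVote C) (δ : Fin n → ℕ → ℕ)
    (hmono : ∀ i, Monotone (δ i)) (hzero : ∀ i, δ i 0 = 0)
    (p : C) (k : ℕ)
    (A : Fin n → Finset C)
    (hdisj : ∀ i, ∀ x ∈ A i, x ∉ (vts i).ranking)
    (W : Fin n → FBVote C)
    (hW : ∀ i, ∃ L : List C, L.toFinset = A i ∧ (W i).ranking = (vts i).ranking ++ L)
    (hcost : ∑ i, δ i (A i).card ≤ k)
    (hwin : UniqueFallbackWinner (ufprof (List.ofFn W)) p) :
    ∃ W' : Fin n → FBVote C,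
      (∀ i, (p ∈ A i → (W' i).ranking = (vts i).ranking ++ [p]) ∧
            (p ∉ A i → W' i = vts i)) ∧
      UniqueFallbackWinner (ufprof (List.ofFn W')) p ∧
      (∑ i, δ i (if p ∈ A i then 1 else 0)) ≤ k := by
  have hnd : ∀ i, p ∈ A i → ((vts i).ranking ++ [p]).Nodup := by
    intro i hi
    have h1 := hdisj i p hi
    have h2 := (vts i).nodup
    rw [List.nodup_append]
    refine ⟨h2, by simp, ?_⟩
    intro a ha b hb
    rw [List.mem_singleton] at hb
    rintro rfl
    subst hb
    exact h1 ha
  let W' : Fin n → FBVote C := fun i =>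
    if h : p ∈ A i then ⟨(vts i).ranking ++ [p], hnd i h⟩ else vts i
  have hW1 : ∀ i, p ∈ A i → (W' i).ranking = (vts i).ranking ++ [p] := by
    intro i hi
    simp [W', hi]
  have hW2 : ∀ i, p ∉ A i → W' i = vts i := by
    intro i hi
    simp [W', hi]
  have memp : ∀ i, p ∈ (W' i).ranking ↔ p ∈ (W i).ranking := by
    intro i
    obtain ⟨L, hL, hr⟩ := hW i
    have hpL : p ∈ L ↔ p ∈ A i := by rw [← hL, List.mem_toFinset]
    by_cases hi : p ∈ A i
    · rw [hW1 i hi, hr]; simp [hpL, hi]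
    · rw [hW2 i hi, hr]; simp [hpL, hi]
  have memd : ∀ i d j, d ≠ p → d ∈ (W' i).ranking.take j → d ∈ (W i).ranking.take j := by
    intro i d j hd hm
    obtain ⟨L, hL, hr⟩ := hW i
    have : d ∈ (vts i).ranking.take j := by
      by_cases hi : p ∈ A i
      · rw [hW1 i hi, List.take_append, List.mem_append] at hm
        rcases hm with hm | hm
        · exact hm
        · exact absurd (List.mem_singleton.mp (List.mem_of_mem_take hm)) hd
      · rwa [hW2 i hi] at hm
    rw [hr, List.take_append, List.mem_append]
    exact Or.inl this
  have mempj : ∀ i j, p ∈ (W i).ranking.take j → p ∈ (W' i).ranking.take j := by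
    intro i j hm
    obtain ⟨L, hL, hr⟩ := hW i
    have hpL : p ∈ L ↔ p ∈ A i := by rw [← hL, List.mem_toFinset]
    rw [hr, List.take_append, List.mem_append] at hm
    by_cases hi : p ∈ A i
    · rw [hW1 i hi, List.take_append, List.mem_append]
      rcases hm with hm | hm
      · exact Or.inl hm
      · right
        cases hk : j - (vts i).ranking.length with
        | zero => rw [hk] at hm; simp at hm
        | succ m => simp
    · rw [hW2 i hi]
      rcases hm with hm | hm
      · exact hm
      · exact absurd (hpL.mp (List.mem_of_mem_take hm)) hi
  have memd2 : ∀ i d, d ≠ p → d ∈ (W' i).ranking → d ∈ (W i).ranking := by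
    intro i d hd hm
    have := memd i d (W' i).ranking.length hd (by rwa [List.take_length])
    exact List.mem_of_mem_take this
  refine ⟨W', fun i => ⟨hW1 i, hW2 i⟩, ?_, ?_⟩
  · refine aux_main _ _ p ?_ ?_ ?_ ?_ ?_ ?_ ?_ hwin
    · rw [aux_maj, aux_maj]
    · intro j d hd
      rw [aux_level, aux_level]
      exact Finset.sum_le_sum fun i _ => aux_ite (memd i d j hd)
    · intro j
      rw [aux_level, aux_level]
      exact Finset.sum_le_sum fun i _ => aux_ite (mempj i j)
    · intro d hd
      rw [aux_appr, aux_appr]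
      exact Finset.sum_le_sum fun i _ => aux_ite (memd2 i d hd)
    · rw [aux_appr, aux_appr]
      exact Finset.sum_congr rfl fun i _ => by simp only [memp i]
    · intro j
      rw [aux_level, aux_appr]
      exact Finset.sum_le_sum fun i _ => aux_ite List.mem_of_mem_take
    · refine ⟨∑ i, (W i).ranking.length, ?_⟩
      rw [aux_level, aux_appr]
      refine Finset.sum_le_sum fun i _ => aux_ite fun h => ?_
      rwa [List.take_of_length_le]
      exact Finset.single_le_sum (f := fun i => (W i).ranking.length)
        (fun _ _ => Nat.zero_le _) (Finset.mem_univ i)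
  · refine le_trans (Finset.sum_le_sum fun i _ => hmono i ?_) hcost
    split_ifs with h
    · exact Finset.card_pos.mpr ⟨p, h⟩
    · exact Nat.zero_le _
end

section
/- Let (C,V) be a weighted fallback election, let p ∈ C, and let nonnegative integer weights w'_1,…,w'_k be given for k manipulators. If there exists a list S of k fallback votes over C, of weights w'_1,…,w'_k, such that p is NOT the unique fallback winner of (C, V ∪ S), then there exists a candidate c ∈ C − {p} such that p is not the unique fallback winner of (C, V ∪ T_c), where T_c consists of k votes of weights w'_1,…,w'_k each approving exactly the set {c}. -/
open Voting

theorem exists_fallbackWinner {C : Type*} [Fintype C] [Nonempty C] [DecidableEq C]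
    (P : Profile C) : ∃ d, FallbackWinner P d := by
  by_cases hs : someMaj P
  · obtain ⟨d, hd⟩ := Finite.exists_max (fun d => levelScore P (majLevel P) d)
    have hne : {j : ℕ | ∃ d : C, maj P ≤ levelScore P j d}.Nonempty := hs
    obtain ⟨e, he⟩ := Nat.sInf_mem hne
    exact ⟨d, Or.inl ⟨hs, le_trans he (hd e), hd⟩⟩
  · obtain ⟨d, hd⟩ := Finite.exists_max (fun d => approvalScore P d)
    exact ⟨d, Or.inr ⟨hs, hd⟩⟩

theorem not_unique_of_shift {C : Type*} [DecidableEq C] (P Q : Profile C) (p d : C)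
    (hdp : d ≠ p) (hm : maj Q = maj P)
    (hd : ∀ j, levelScore P j d ≤ levelScore Q j d)
    (hp : ∀ j, levelScore Q j p ≤ levelScore P j p)
    (had : approvalScore P d ≤ approvalScore Q d)
    (hap : approvalScore Q p ≤ approvalScore P p)
    (hw : FallbackWinner P d) : ¬ UniqueFallbackWinner Q p := by
  rintro ⟨hpw, huniq⟩
  rcases hpw with ⟨hs, hb1, hb2⟩ | ⟨hs, hb⟩
  · have hlt : levelScore Q (majLevel Q) d < levelScore Q (majLevel Q) p := by
      by_contra hcon
      push Not at hcon
      exact hdp (huniq d (Or.inl ⟨hs, hb1.trans hcon, fun e => (hb2 e).trans hcon⟩))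
    have h1 : maj P ≤ levelScore P (majLevel Q) p := hm ▸ hb1.trans (hp _)
    rcases hw with ⟨_, hw1, hw2⟩ | ⟨hns, _⟩
    · have e1 : majLevel P ≤ majLevel Q := Nat.sInf_le ⟨p, h1⟩
      have e2 : majLevel Q ≤ majLevel P :=
        Nat.sInf_le ⟨d, by rw [hm]; exact hw1.trans (hd _)⟩
      have e : majLevel P = majLevel Q := le_antisymm e1 e2
      rw [e] at hw2
      have a1 := hw2 p
      have a2 := hp (majLevel Q)
      have a3 := hd (majLevel Q)
      omega
    · exact hns ⟨_, p, h1⟩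
  · have hlt : approvalScore Q d < approvalScore Q p := by
      by_contra hcon
      push Not at hcon
      exact hdp (huniq d (Or.inr ⟨hs, fun e => (hb e).trans hcon⟩))
    rcases hw with ⟨_, hw1, _⟩ | ⟨_, hw2⟩
    · exact hs ⟨majLevel P, d, by rw [hm]; exact hw1.trans (hd _)⟩
    · have a1 := hw2 p
      omega

/-- in a weighted fallback election, if some list `S` of `k` manipulative
votes of weights `w 0, …, w (k-1)` prevents `p` from being the unique fallback winner of
`(C, V ∪ S)`, then there is a candidate `c ≠ p` such that the `k` votes of the same
weights each approving exactly `{c}` also prevent `p` from being the unique fallback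
winner. -/
theorem stmt_18 {C : Type*} [Fintype C] [DecidableEq C]
    (V : List (FBVote C × ℕ)) (p : C) (k : ℕ) (w : Fin k → ℕ)
    (S : Fin k → FBVote C)
    (h : ¬ UniqueFallbackWinner (fprof (V ++ List.ofFn (fun i => (S i, w i)))) p) :
    ∃ c : C, c ≠ p ∧
      ¬ UniqueFallbackWinner
        (fprof (V ++ List.ofFn (fun i =>
          ((⟨[c], List.nodup_singleton c⟩ : FBVote C), w i)))) p := by
  haveI : Nonempty C := ⟨p⟩
  obtain ⟨d, hdp, hw⟩ : ∃ d, d ≠ p ∧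
      FallbackWinner (fprof (V ++ List.ofFn (fun i => (S i, w i)))) d := by
    by_contra hcon
    push Not at hcon
    have hall : ∀ d, FallbackWinner (fprof (V ++ List.ofFn (fun i => (S i, w i)))) d → d = p := by
      intro d hd
      by_contra hne
      exact hcon d hne hd
    obtain ⟨e, he⟩ := exists_fallbackWinner (fprof (V ++ List.ofFn (fun i => (S i, w i))))
    exact h ⟨hall e he ▸ he, hall⟩
  refine ⟨d, hdp, not_unique_of_shift _ _ p d hdp ?_ ?_ ?_ ?_ ?_ hw⟩
  · simp [maj, totalWeight, fprof, List.map_ofFn, Function.comp_def]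
  · intro j
    simp only [levelScore, fprof, List.map_append, List.sum_append, List.map_ofFn,
      Function.comp_def, List.sum_ofFn]
    gcongr with i
    rcases j with _ | j
    · simp
    · simp only [List.take_succ_cons, List.mem_cons, true_or, if_true]
      split_ifs <;> omega
  · intro j
    simp only [levelScore, fprof, List.map_append, List.sum_append, List.map_ofFn,
      Function.comp_def, List.sum_ofFn]
    gcongr with i
    rw [if_neg]
    · exact Nat.zero_le _
    · intro hmem
      exact hdp (List.mem_singleton.mp (List.mem_of_mem_take hmem)).symm
  · simp only [approvalScore, fprof, List.map_append, List.sum_append, List.map_ofFn,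
      Function.comp_def, List.sum_ofFn]
    gcongr with i
    simp only [List.mem_singleton, if_true]
    split_ifs <;> omega
  · simp only [approvalScore, fprof, List.map_append, List.sum_append, List.map_ofFn,
      Function.comp_def, List.sum_ofFn]
    gcongr with i
    simp [hdp.symm]
end
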